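/- arXiv:1106.1868 — 2 statements merged into one kernel-verified Lean document; each statement's English description precedes it below -/
import Mathlib

section
/- Let 1 < σ ≤ 1.15, set σ1 = 1/2 + (1/2)·√(1+4σ²), let k ∈ {1,2,3,4}, and let γ0 ≥ 1. Then F(σ + i·k·γ0, 1) − κ·F(σ1 + i·k·γ0, 1) ≤ 1.6666. -/
namespace ZFR

noncomputable def kappa : ℝ := 1 / Real.sqrt 5

noncomputable def sigma1 (σ : ℝ) : ℝ := 1 / 2 + Real.sqrt (1 + 4 * σ ^ 2) / 2

/-- `F(s,z) = Re( 1/(s-z) + 1/(s-1+conj z) )`. -/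
noncomputable def F (s z : ℂ) : ℝ :=
  (1 / (s - z) + 1 / (s - 1 + (starRingEnd ℂ) z)).re

/-- For real `σ`, `t`, the value of `F` at `z = 1` as a real rational expression. -/
theorem F_one (σ t : ℝ) :
    F ((σ : ℂ) + (t : ℝ) * Complex.I) 1
      = (σ - 1) / ((σ - 1) ^ 2 + t ^ 2) + σ / (σ ^ 2 + t ^ 2) := by
  simp [F, Complex.normSq_apply, pow_two]

theorem div_sq_add_sq_le_half (a t : ℝ) (ht : 1 ≤ t) : a / (a ^ 2 + t ^ 2) ≤ 1 / 2 := by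
  rw [div_le_iff₀ (by positivity)]
  nlinarith [sq_nonneg (a - 1)]

theorem F_one_nonneg {σ : ℝ} (t : ℝ) (hσ : 1 ≤ σ) :
    0 ≤ F ((σ : ℂ) + (t : ℝ) * Complex.I) 1 := by
  rw [F_one]
  have : 0 ≤ σ - 1 := sub_nonneg.2 hσ
  positivity

theorem one_le_sigma1 (σ : ℝ) : 1 ≤ sigma1 σ := by
  have : 1 ≤ Real.sqrt (1 + 4 * σ ^ 2) := Real.one_le_sqrt.2 (by nlinarith [sq_nonneg σ])
  unfold sigma1
  linarith

/-- For `1 < σ ≤ 1.15`, `k ∈ {1,2,3,4}`, `γ0 ≥ 1`: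
`F(σ+ikγ0,1) - κ F(σ1+ikγ0,1) ≤ 1.6666`. -/
theorem pole_term_large_t (σ γ0 : ℝ) (hσ : 1 < σ) (hσ' : σ ≤ 1.15)
    (k : ℕ) (hk1 : 1 ≤ k) (hk4 : k ≤ 4) (hγ0 : 1 ≤ γ0) :
    F ((σ : ℂ) + ((k : ℝ) * γ0 : ℝ) * Complex.I) 1
        - kappa * F ((sigma1 σ : ℂ) + ((k : ℝ) * γ0 : ℝ) * Complex.I) 1
      ≤ 1.6666 := by
  have hk : (1 : ℝ) ≤ k := by exact_mod_cast hk1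
  have ht : 1 ≤ (k : ℝ) * γ0 := one_le_mul_of_one_le_of_one_le hk hγ0
  have hκ : 0 ≤ kappa := by unfold kappa; positivity
  have hF := mul_nonneg hκ (F_one_nonneg ((k : ℝ) * γ0) (one_le_sigma1 σ))
  have h₁ := div_sq_add_sq_le_half (σ - 1) _ ht
  have h₂ := div_sq_add_sq_le_half σ _ ht
  have h := F_one σ ((k : ℝ) * γ0)
  have : (1 : ℝ) ≤ 1.6666 := by norm_num
  linarith

end ZFR
end

section
/- Let 1 < σ ≤ 1.15, set σ1 = 1/2 + (1/2)·√(1+4σ²), let c ∈ {0,1}, let k ∈ {1,2,3,4}, and let 0 < γ0 ≤ 1. Then (1/2)·Re( ψ((σ + i·k·γ0 + c)/2) − κ·ψ((σ1 + i·k·γ0 + c)/2) ) ≤ d(k), where d(1) = −0.0390, d(2) = 0.2469, d(3) = 0.4452, d(4) = 0.5842, and ψ = Γ'/Γ is the logarithmic derivative of the Gamma function. -/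
namespace ZFR

/-- `ψ = Γ'/Γ`, the logarithmic derivative of the complex Gamma function. -/
noncomputable def psi (s : ℂ) : ℂ := logDeriv Complex.Gamma s

open Filter Topology

/-- The summands of the logarithm of the Euler product for `Γ(s + 1)`. -/
noncomputable def logGammaTerm (m : ℕ) (s : ℂ) : ℂ :=
  s * (Real.log ((m + 2) / (m + 1)) : ℂ) - Complex.log (1 + s / (m + 1))

lemma one_add_div_re_pos {s : ℂ} (hs : -(1 / 2) < s.re) (m : ℕ) :
    0 < (1 + s / ((m : ℂ) + 1)).re := by
  have hm : (0 : ℝ) < (m : ℝ) + 1 := by positivity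
  have h : (s / ((m : ℂ) + 1)).re = s.re / ((m : ℝ) + 1) := by
    rw [← Complex.div_ofReal_re]; push_cast; rfl
  rw [Complex.add_re, h, Complex.one_re, ← sub_neg_eq_add, sub_pos, ← neg_div, div_lt_one hm]
  have : (0 : ℝ) ≤ m := m.cast_nonneg
  linarith

lemma hasDerivAt_logGammaTerm (m : ℕ) {s : ℂ} (hs : -(1 / 2) < s.re) :
    HasDerivAt (logGammaTerm m)
      ((Real.log ((m + 2) / (m + 1)) : ℂ) - 1 / (s + (m + 1))) s := by
  have hm : (m : ℂ) + 1 ≠ 0 := by exact_mod_cast m.succ_ne_zero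
  have hpos := one_add_div_re_pos hs m
  have hne : 1 + s / ((m : ℂ) + 1) ≠ 0 := fun h => by rw [h] at hpos; simp at hpos
  have hne' : s + ((m : ℂ) + 1) ≠ 0 := by
    intro h
    apply hne
    field_simp
    linear_combination h
  have h1 : HasDerivAt (fun z : ℂ => 1 + z / ((m : ℂ) + 1)) (1 / ((m : ℂ) + 1)) s :=
    ((hasDerivAt_id s).div_const _).const_add 1
  have h2 := h1.clog (Or.inl hpos)
  have h3 := ((hasDerivAt_id s).mul_const ((Real.log ((m + 2) / (m + 1)) : ℝ) : ℂ)).sub h2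
  have e : (Real.log ((m + 2) / (m + 1)) : ℂ) - 1 / (s + (m + 1))
      = 1 * (Real.log ((m + 2) / (m + 1)) : ℂ) - 1 / ((m : ℂ) + 1) / (1 + s / ((m : ℂ) + 1)) := by
    rw [one_mul, div_div, mul_add, mul_one, mul_div_cancel₀ _ hm, add_comm s]
  rw [e]
  exact h3

lemma abs_log_ratio_sub_le (m : ℕ) :
    |Real.log (((m : ℝ) + 2) / (m + 1)) - 1 / (m + 1)| ≤ 1 / ((m : ℝ) + 1) ^ 2 := by
  have hm : (0 : ℝ) < (m : ℝ) + 1 := by positivity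
  have hr : (0 : ℝ) < ((m : ℝ) + 2) / (m + 1) := by positivity
  have h1 := Real.log_le_sub_one_of_pos hr
  have h2 := Real.one_sub_inv_le_log_of_pos hr
  have e1 : ((m : ℝ) + 2) / (m + 1) - 1 = 1 / (m + 1) := by field_simp; ring
  have e2 : 1 - (((m : ℝ) + 2) / (m + 1))⁻¹ = 1 / (m + 2) := by field_simp; ring
  have e3 : 1 / ((m : ℝ) + 1) - 1 / ((m : ℝ) + 1) ^ 2 ≤ 1 / (m + 2) := by
    rw [div_sub_div _ _ (by positivity) (by positivity), div_le_div_iff₀ (by positivity)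
      (by positivity)]
    nlinarith [pow_pos hm 2]
  rw [abs_le]
  constructor
  · linarith
  · have : 0 ≤ 1 / ((m : ℝ) + 1) ^ 2 := by positivity
    linarith

lemma norm_deriv_logGammaTerm_le {R : ℝ} {s : ℂ} (hs : -(1 / 2) < s.re) (hR : ‖s‖ ≤ R) (m : ℕ) :
    ‖(Real.log ((m + 2) / (m + 1)) : ℂ) - 1 / (s + (m + 1))‖
      ≤ (1 + 2 * R) * (1 / ((m : ℝ) + 1) ^ 2) := by
  have hm : (0 : ℝ) < (m : ℝ) + 1 := by positivity
  have hmc : (m : ℂ) + 1 ≠ 0 := by exact_mod_cast m.succ_ne_zero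
  have hm0 : (0 : ℝ) ≤ m := m.cast_nonneg
  have hn : ((m : ℝ) + 1) / 2 ≤ ‖s + ((m : ℂ) + 1)‖ := by
    refine le_trans ?_ (Complex.re_le_norm _)
    simp only [Complex.add_re, Complex.natCast_re, Complex.one_re]
    linarith
  have hne : s + ((m : ℂ) + 1) ≠ 0 := norm_pos_iff.1 (by linarith)
  have e : (Real.log ((m + 2) / (m + 1)) : ℂ) - 1 / (s + (m + 1))
      = ((Real.log ((m + 2) / (m + 1)) - 1 / (m + 1) : ℝ) : ℂ)
        + s / (((m : ℂ) + 1) * (s + (m + 1))) := by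
    push_cast
    field_simp
    ring
  rw [e, add_mul (1 : ℝ), one_mul (1 / ((m : ℝ) + 1) ^ 2)]
  refine (norm_add_le _ _).trans (add_le_add ?_ ?_)
  · rw [Complex.norm_real]
    exact abs_log_ratio_sub_le m
  · have e4 : ‖(m : ℂ) + 1‖ = (m : ℝ) + 1 := by
      rw [show (m : ℂ) + 1 = (((m : ℝ) + 1 : ℝ) : ℂ) by push_cast; rfl, Complex.norm_real]
      exact abs_of_pos hm
    rw [norm_div, norm_mul, e4, mul_one_div, div_le_div_iff₀ (by positivity) (by positivity)]
    have hR0 : 0 ≤ R := (norm_nonneg s).trans hR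
    calc ‖s‖ * ((m : ℝ) + 1) ^ 2 ≤ R * ((m : ℝ) + 1) ^ 2 := by gcongr
      _ = 2 * R * (((m : ℝ) + 1) * (((m : ℝ) + 1) / 2)) := by ring
      _ ≤ 2 * R * (((m : ℝ) + 1) * ‖s + ((m : ℂ) + 1)‖) := by gcongr

lemma summable_const_mul_one_div_succ_sq (C : ℝ) :
    Summable fun m : ℕ => C * (1 / ((m : ℝ) + 1) ^ 2) := by
  have h := (summable_nat_add_iff 1).2 (Real.summable_one_div_nat_pow.2 one_lt_two)
  simpa using h.mul_left C

/-- A bounded convex domain on which the series of `logGammaTerm` converges nicely. -/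
lemma logGammaTerm_domain (R : ℝ) :
    IsOpen ({s : ℂ | -(1 / 2) < s.re} ∩ Metric.ball 0 R) ∧
      IsPreconnected ({s : ℂ | -(1 / 2) < s.re} ∩ Metric.ball 0 R) :=
  ⟨(isOpen_lt continuous_const Complex.continuous_re).inter Metric.isOpen_ball,
    ((convex_halfSpace_re_gt _).inter (convex_ball _ _)).isPreconnected⟩

lemma logGammaTerm_zero (m : ℕ) : logGammaTerm m 0 = 0 := by
  simp [logGammaTerm]

lemma summable_logGammaTerm {s : ℂ} (hs : -(1 / 2) < s.re) :
    Summable fun m => logGammaTerm m s := by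
  obtain ⟨ho, hp⟩ := logGammaTerm_domain (‖s‖ + 1)
  refine summable_of_summable_hasDerivAt_of_isPreconnected
    (summable_const_mul_one_div_succ_sq (1 + 2 * (‖s‖ + 1))) ho hp
    (fun m z hz => hasDerivAt_logGammaTerm m hz.1)
    (fun m z hz => norm_deriv_logGammaTerm_le hz.1 (mem_ball_zero_iff.1 hz.2).le m)
    (y₀ := 0) ?_ ?_ ?_
  · exact ⟨by simp, by simp; positivity⟩
  · simp [logGammaTerm_zero]
  · exact ⟨hs, by simp⟩

lemma hasDerivAt_tsum_logGammaTerm {s : ℂ} (hs : -(1 / 2) < s.re) :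
    HasDerivAt (fun z => ∑' m, logGammaTerm m z)
      (∑' m : ℕ, ((Real.log ((m + 2) / (m + 1)) : ℂ) - 1 / (s + (m + 1)))) s := by
  obtain ⟨ho, hp⟩ := logGammaTerm_domain (‖s‖ + 1)
  refine hasDerivAt_tsum_of_isPreconnected
    (summable_const_mul_one_div_succ_sq (1 + 2 * (‖s‖ + 1))) ho hp
    (fun m z hz => hasDerivAt_logGammaTerm m hz.1)
    (fun m z hz => norm_deriv_logGammaTerm_le hz.1 (mem_ball_zero_iff.1 hz.2).le m)
    (y₀ := 0) ?_ ?_ ?_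
  · exact ⟨by simp, by simp; positivity⟩
  · simp [logGammaTerm_zero]
  · exact ⟨hs, by simp⟩

lemma sum_log_ratio (n : ℕ) :
    ∑ m ∈ Finset.range n, Real.log (((m : ℝ) + 2) / (m + 1)) = Real.log ((n : ℝ) + 1) := by
  induction n with
  | zero => simp
  | succ n ih =>
    rw [Finset.sum_range_succ, ih, Real.log_div (by positivity) (by positivity)]
    push_cast
    ring_nf

lemma exp_sum_logGammaTerm {s : ℂ} (hs : 0 < s.re) (n : ℕ) :
    Complex.exp (∑ m ∈ Finset.range n, logGammaTerm m s) / s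
      = ((n : ℂ) + 1) ^ s * n.factorial / ∏ j ∈ Finset.range (n + 1), (s + j) := by
  have hs0 : s ≠ 0 := fun h => by simp [h] at hs
  have hprod : ∀ n : ℕ, (∏ m ∈ Finset.range n, (1 + s / ((m : ℂ) + 1))) * (s * n.factorial)
      = ∏ j ∈ Finset.range (n + 1), (s + j) := by
    intro n
    induction n with
    | zero => simp
    | succ n ih =>
      have hn : (n : ℂ) + 1 ≠ 0 := by exact_mod_cast n.succ_ne_zero
      rw [Finset.prod_range_succ _ (n + 1), ← ih, Finset.prod_range_succ, Nat.factorial_succ]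
      push_cast
      field_simp
      ring
  have hne : ∀ m : ℕ, 1 + s / ((m : ℂ) + 1) ≠ 0 := fun m h => by
    have := one_add_div_re_pos (show -(1 / 2) < s.re by linarith) m
    rw [h] at this; simp at this
  have hn : (n : ℂ) + 1 ≠ 0 := by exact_mod_cast n.succ_ne_zero
  have hpow : Complex.exp (s * ∑ m ∈ Finset.range n, (Real.log ((m + 2) / (m + 1)) : ℂ))
      = ((n : ℂ) + 1) ^ s := by
    rw [← Complex.ofReal_sum, sum_log_ratio, Complex.cpow_def_of_ne_zero hn,
      Complex.ofReal_log (by positivity), mul_comm]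
    push_cast
    rfl
  have hP : ∏ m ∈ Finset.range n, (1 + s / ((m : ℂ) + 1)) ≠ 0 :=
    Finset.prod_ne_zero_iff.2 fun m _ => hne m
  have hf : (n.factorial : ℂ) ≠ 0 := by exact_mod_cast n.factorial_ne_zero
  simp only [logGammaTerm, Finset.sum_sub_distrib, ← Finset.mul_sum]
  rw [Complex.exp_sub, Complex.exp_sum, hpow, ← hprod n,
    Finset.prod_congr rfl fun m _ => Complex.exp_log (hne m)]
  field_simp

lemma Gamma_eq_exp_tsum {s : ℂ} (hs : 0 < s.re) :
    Complex.Gamma s = Complex.exp (∑' m, logGammaTerm m s) / s := by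
  have h1 : Tendsto (fun n : ℕ => Complex.exp (∑ m ∈ Finset.range n, logGammaTerm m s) / s)
      atTop (𝓝 (Complex.exp (∑' m, logGammaTerm m s) / s)) :=
    ((Complex.continuous_exp.tendsto _).comp
      (summable_logGammaTerm (by linarith)).hasSum.tendsto_sum_nat).div_const s
  have h2 : Tendsto (fun n : ℕ => ((n : ℂ) / ((n : ℂ) + 1)) ^ s) atTop (𝓝 1) := by
    have := (tendsto_natCast_div_add_atTop (𝕜 := ℂ) 1)
    have h := this.cpow (tendsto_const_nhds (x := s)) (Or.inl (by simp))
    simpa using h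
  have h3 := h1.mul h2
  rw [mul_one] at h3
  refine tendsto_nhds_unique (Complex.GammaSeq_tendsto_Gamma s) (h3.congr fun n => ?_)
  rw [exp_sum_logGammaTerm hs, Complex.GammaSeq]
  have hn : ((n : ℂ) + 1) ^ s ≠ 0 := by
    rw [Complex.cpow_ne_zero_iff]
    left
    exact_mod_cast n.succ_ne_zero
  have hd : ((n : ℂ) / ((n : ℂ) + 1)) ^ s = (n : ℂ) ^ s / ((n : ℂ) + 1) ^ s := by
    have := Complex.div_cpow_ofReal_nonneg (a := (n : ℝ)) (b := (n : ℝ) + 1) (by positivity)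
      (by positivity) s
    simpa using this
  rw [hd]
  field_simp

lemma psi_eq_tsum {s : ℂ} (hs : 0 < s.re) :
    psi s = (∑' m : ℕ, ((Real.log ((m + 2) / (m + 1)) : ℂ) - 1 / (s + (m + 1)))) - 1 / s := by
  have hs0 : s ≠ 0 := fun h => by simp [h] at hs
  have hev : Complex.Gamma =ᶠ[𝓝 s] fun z => Complex.exp (∑' m, logGammaTerm m z) / z := by
    filter_upwards [(isOpen_lt continuous_const Complex.continuous_re).mem_nhds hs] with z hz
    exact Gamma_eq_exp_tsum hz
  have hd := ((hasDerivAt_tsum_logGammaTerm (s := s) (by linarith)).cexp).div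
    (hasDerivAt_id s) hs0
  rw [psi, (logDeriv_congr_nhds hev).eq_of_nhds, logDeriv_apply]
  erw [hd.deriv]
  have := Complex.exp_ne_zero (∑' m, logGammaTerm m s)
  simp only [id]
  field_simp

/-- The Gauss limit formula for the digamma function. -/
lemma tendsto_psi {s : ℂ} (hs : 0 < s.re) :
    Tendsto (fun n : ℕ => (Real.log ((n : ℝ) + 1) : ℂ) - ∑ j ∈ Finset.range (n + 1), 1 / (s + j))
      atTop (𝓝 (psi s)) := by
  have hsum : Summable fun m : ℕ => ((Real.log ((m + 2) / (m + 1)) : ℂ) - 1 / (s + (m + 1))) :=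
    Summable.of_norm_bounded (summable_const_mul_one_div_succ_sq (1 + 2 * ‖s‖))
      (norm_deriv_logGammaTerm_le (by linarith) le_rfl)
  rw [psi_eq_tsum hs]
  refine (hsum.hasSum.tendsto_sum_nat.sub_const (1 / s)).congr fun n => ?_
  rw [Finset.sum_sub_distrib, ← Complex.ofReal_sum, sum_log_ratio, Finset.sum_range_succ']
  push_cast
  ring

lemma re_one_div_add_nat (x y : ℝ) (j : ℕ) :
    (1 / ((x : ℂ) + y * Complex.I + j)).re = (x + j) / ((x + j) ^ 2 + y ^ 2) := by
  rw [one_div, Complex.inv_re, Complex.normSq_apply]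
  simp [sq]

lemma tendsto_re_psi {x : ℝ} (hx : 0 < x) (y : ℝ) :
    Tendsto (fun n : ℕ => Real.log ((n : ℝ) + 1)
        - ∑ j ∈ Finset.range (n + 1), (x + j) / ((x + j) ^ 2 + y ^ 2))
      atTop (𝓝 (psi (x + y * Complex.I)).re) := by
  have h := (Complex.continuous_re.tendsto _).comp
    (tendsto_psi (s := (x : ℂ) + y * Complex.I) (by simpa using hx))
  refine h.congr fun n => ?_
  simp only [Function.comp, Complex.sub_re, Complex.ofReal_re, Complex.re_sum, re_one_div_add_nat]

lemma re_psi_add_one {x : ℝ} (hx : 0 < x) (y : ℝ) :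
    (psi ((x + 1 : ℝ) + y * Complex.I)).re
      = (psi (x + y * Complex.I)).re + x / (x ^ 2 + y ^ 2) := by
  have h := Complex.digamma_apply_add_one ((x : ℂ) + y * Complex.I) fun m hm => by
    have := congrArg Complex.re hm
    simp at this
    have : (0 : ℝ) ≤ m := m.cast_nonneg
    linarith
  have e : (((x + 1 : ℝ) : ℂ) + y * Complex.I) = (x : ℂ) + y * Complex.I + 1 := by
    push_cast; ring
  have h0 := re_one_div_add_nat x y 0
  simp only [Nat.cast_zero, add_zero, one_div] at h0
  rw [e, ← h0, ← Complex.add_re]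
  exact congrArg Complex.re h

lemma tendsto_log_sub_half_log_quadratic (x w : ℝ) :
    Tendsto (fun n : ℕ => Real.log ((n : ℝ) + 1)
        - Real.log ((x + (n + 1 : ℕ)) ^ 2 - (x + (n + 1 : ℕ)) + w) / 2) atTop (𝓝 0) := by
  have hinv : Tendsto (fun n : ℕ => 1 / ((n : ℝ) + 1)) atTop (𝓝 0) :=
    tendsto_one_div_add_atTop_nhds_zero_nat
  have hq : Tendsto (fun n : ℕ => 1 + (2 * x - 1) * (1 / ((n : ℝ) + 1))
      + (x ^ 2 - x + w) * (1 / ((n : ℝ) + 1)) ^ 2) atTop (𝓝 1) := by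
    have := ((hinv.const_mul (2 * x - 1)).const_add 1).add ((hinv.pow 2).const_mul (x ^ 2 - x + w))
    simpa using this
  have hlog := ((hq.log one_ne_zero).div_const 2).neg
  simp only [Real.log_one, zero_div, neg_zero] at hlog
  refine hlog.congr' ?_
  filter_upwards [hq.eventually (lt_mem_nhds zero_lt_one)] with n hn
  have hm : (0 : ℝ) < (n : ℝ) + 1 := by positivity
  have e : (x + (n + 1 : ℕ)) ^ 2 - (x + (n + 1 : ℕ)) + w
      = ((n : ℝ) + 1) ^ 2 * (1 + (2 * x - 1) * (1 / ((n : ℝ) + 1))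
      + (x ^ 2 - x + w) * (1 / ((n : ℝ) + 1)) ^ 2) := by
    push_cast
    field_simp
    ring
  rw [e, Real.log_mul (by positivity) hn.ne', Real.log_pow]
  push_cast
  ring

lemma half_log_step_le {x Y : ℝ} (hx : 0 < x) (hY : 0 ≤ Y) :
    Real.log ((x + 1) ^ 2 - (x + 1) + (Y + 1)) / 2 - Real.log (x ^ 2 - x + (Y + 1)) / 2
      ≤ x / (x ^ 2 + Y) := by
  have hq : 0 < x ^ 2 - x + (Y + 1) := by nlinarith [sq_nonneg (x - 1)]
  have hp : 0 < x ^ 2 + x + (Y + 1) := by positivity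
  have e : (x + 1) ^ 2 - (x + 1) + (Y + 1) = x ^ 2 + x + (Y + 1) := by ring
  rw [e, ← sub_div, ← Real.log_div hp.ne' hq.ne']
  set p := x ^ 2 + x + (Y + 1) with hpdef
  set q := x ^ 2 - x + (Y + 1) with hqdef
  have hR : 1 ≤ p / q := by rw [one_le_div hq]; linarith
  have hlog : Real.log (p / q) ≤ (p / q - q / p) / 2 := by
    rw [← inv_div p q, ← Real.sinh_log (by positivity)]
    exact Real.self_le_sinh_iff.2 (Real.log_nonneg hR)
  refine (div_le_div_of_nonneg_right hlog zero_le_two).trans ?_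
  have hxY : 0 < x ^ 2 + Y := by positivity
  rw [div_sub_div _ _ hq.ne' hp.ne', div_div, div_div, div_le_div_iff₀ (by positivity) hxY]
  have e2 : p * p - q * q = 4 * x * (x ^ 2 + Y + 1) := by rw [hpdef, hqdef]; ring
  have e3 : q * p = (x ^ 2 + Y + 1) ^ 2 - x ^ 2 := by rw [hpdef, hqdef]; ring
  rw [e2, e3]
  nlinarith [mul_nonneg hx.le (by linarith : (0:ℝ) ≤ Y + 1)]

lemma le_half_log_step {x Y : ℝ} (hx : 1 ≤ x) (hY : 0 < Y) :
    x / (x ^ 2 + Y)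
      ≤ Real.log ((x + 1) ^ 2 - (x + 1) + Y) / 2 - Real.log (x ^ 2 - x + Y) / 2 := by
  have hq : 0 < x ^ 2 - x + Y := by nlinarith
  have hp : 0 < x ^ 2 + x + Y := by positivity
  have e : (x + 1) ^ 2 - (x + 1) + Y = x ^ 2 + x + Y := by ring
  rw [e, ← sub_div, ← Real.log_div hp.ne' hq.ne']
  set p := x ^ 2 + x + Y with hpdef
  set q := x ^ 2 - x + Y with hqdef
  have hR : 1 ≤ p / q := by rw [one_le_div hq]; linarith
  have h := Real.le_log_one_add_of_nonneg (sub_nonneg.2 hR)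
  have e2 : 2 * (p / q - 1) / (p / q - 1 + 2) = 2 * ((p - q) / (p + q)) := by
    rw [show p / q - 1 = (p - q) / q by rw [sub_div, div_self hq.ne'],
      show (p - q) / q + 2 = (p + q) / q by field_simp; ring, ← mul_div_assoc,
      div_div_div_cancel_right₀ hq.ne', mul_div_assoc]
  have e3 : (p - q) / (p + q) = x / (x ^ 2 + Y) := by
    rw [show p - q = 2 * x by rw [hpdef, hqdef]; ring,
      show p + q = 2 * (x ^ 2 + Y) by rw [hpdef, hqdef]; ring, mul_div_mul_left _ _ two_ne_zero]
  rw [add_sub_cancel, e2, e3] at h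
  linarith

lemma re_psi_le {x : ℝ} (hx : 0 < x) (y : ℝ) :
    (psi (x + y * Complex.I)).re ≤ Real.log (x ^ 2 - x + (y ^ 2 + 1)) / 2 := by
  have h := (tendsto_log_sub_half_log_quadratic x (y ^ 2 + 1)).add_const
    (Real.log (x ^ 2 - x + (y ^ 2 + 1)) / 2)
  rw [zero_add] at h
  refine le_of_tendsto_of_tendsto' (tendsto_re_psi hx y) h fun n => ?_
  have hs := Finset.sum_le_sum fun j (_ : j ∈ Finset.range (n + 1)) =>
    half_log_step_le (x := x + j) (by positivity) (sq_nonneg y)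
  have ht := Finset.sum_range_sub
    (fun j : ℕ => Real.log ((x + j) ^ 2 - (x + j) + (y ^ 2 + 1)) / 2) (n + 1)
  simp only [Nat.cast_succ, ← add_assoc, Nat.cast_zero, add_zero] at hs ht ⊢
  linarith

lemma le_re_psi {x y : ℝ} (hx : 1 ≤ x) (hy : 0 < y) :
    Real.log (x ^ 2 - x + y ^ 2) / 2 ≤ (psi (x + y * Complex.I)).re := by
  have h := (tendsto_log_sub_half_log_quadratic x (y ^ 2)).add_const
    (Real.log (x ^ 2 - x + y ^ 2) / 2)
  rw [zero_add] at h
  refine le_of_tendsto_of_tendsto' h (tendsto_re_psi (by linarith) y) fun n => ?_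
  have hs := Finset.sum_le_sum fun j (_ : j ∈ Finset.range (n + 1)) =>
    le_half_log_step (x := x + j) (by have : (0:ℝ) ≤ j := j.cast_nonneg
                                      linarith) (pow_pos hy 2)
  have ht := Finset.sum_range_sub
    (fun j : ℕ => Real.log ((x + j) ^ 2 - (x + j) + y ^ 2) / 2) (n + 1)
  simp only [Nat.cast_succ, ← add_assoc, Nat.cast_zero, add_zero] at hs ht ⊢
  linarith

lemma div_sq_add_sub_antitone {a b r Y Z : ℝ} (ha : 0 < a) (hab : a ≤ b)
    (hrb : r * b ≤ a) (hY : 0 ≤ Y) (hYZ : Y ≤ Z) :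
    a / (a ^ 2 + Z) - r * (b / (b ^ 2 + Z)) ≤ a / (a ^ 2 + Y) - r * (b / (b ^ 2 + Y)) := by
  have hb : 0 < b := ha.trans_le hab
  have hZ : 0 ≤ Z := hY.trans hYZ
  have h1 : a / (a ^ 2 + Y) - a / (a ^ 2 + Z) = a * (Z - Y) / ((a ^ 2 + Y) * (a ^ 2 + Z)) := by
    field_simp; ring
  have h2 : r * (b / (b ^ 2 + Y)) - r * (b / (b ^ 2 + Z))
      = r * b * (Z - Y) / ((b ^ 2 + Y) * (b ^ 2 + Z)) := by
    field_simp; ring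
  have h3 : r * b * (Z - Y) / ((b ^ 2 + Y) * (b ^ 2 + Z))
      ≤ a * (Z - Y) / ((a ^ 2 + Y) * (a ^ 2 + Z)) := by
    have : 0 ≤ Z - Y := by linarith
    gcongr
  linarith

/-- `Re (ψ(a + iy) - r ψ(b + iy))` increases with `y ≥ 0` when `a ≤ b` and `r b ≤ a`, `r ≤ 1`. -/
lemma re_psi_sub_mono {a b r y z : ℝ} (ha : 0 < a) (hab : a ≤ b) (hr1 : r ≤ 1)
    (hrb : r * b ≤ a) (hyz : y ^ 2 ≤ z ^ 2) :
    (psi (a + y * Complex.I)).re - r * (psi (b + y * Complex.I)).re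
      ≤ (psi (a + z * Complex.I)).re - r * (psi (b + z * Complex.I)).re := by
  have hb : 0 < b := ha.trans_le hab
  refine le_of_tendsto_of_tendsto'
    ((tendsto_re_psi ha y).sub ((tendsto_re_psi hb y).const_mul r))
    ((tendsto_re_psi ha z).sub ((tendsto_re_psi hb z).const_mul r)) fun n => ?_
  have hs := Finset.sum_le_sum fun j (_ : j ∈ Finset.range (n + 1)) =>
    div_sq_add_sub_antitone (a := a + j) (b := b + j) (r := r) (Y := y ^ 2) (Z := z ^ 2)
      (by positivity) (by linarith)
      (by have : (0:ℝ) ≤ j := j.cast_nonneg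
          nlinarith) (sq_nonneg y) hyz
  simp only [Finset.sum_sub_distrib, ← Finset.mul_sum] at hs
  linarith

lemma re_psi_sub_le {a b r y : ℝ} (ha : 0 < a) (hb : 0 < b) (hr : 0 ≤ r) (hy : 0 < y) :
    (psi (a + y * Complex.I)).re - r * (psi (b + y * Complex.I)).re
      ≤ Real.log (a ^ 2 + a + y ^ 2 + 1) / 2 - a / (a ^ 2 + y ^ 2)
        - r * (Real.log (b ^ 2 + b + y ^ 2) / 2 - b / (b ^ 2 + y ^ 2)) := by
  have h1 := re_psi_le (x := a + 1) (by positivity) y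
  have h2 := le_re_psi (x := b + 1) (by linarith) hy
  rw [re_psi_add_one ha] at h1
  rw [re_psi_add_one hb] at h2
  rw [show (a + 1) ^ 2 - (a + 1) + (y ^ 2 + 1) = a ^ 2 + a + y ^ 2 + 1 by ring] at h1
  rw [show (b + 1) ^ 2 - (b + 1) + y ^ 2 = b ^ 2 + b + y ^ 2 by ring] at h2
  have h3 := mul_le_mul_of_nonneg_left
    (show Real.log (b ^ 2 + b + y ^ 2) / 2 - b / (b ^ 2 + y ^ 2)
      ≤ (psi (b + y * Complex.I)).re by linarith) hr
  linarith

lemma log_le_div_mul_log_two {x : ℝ} {p n : ℕ} (hn : 0 < n) (hx : 0 < x) (h : x ^ n ≤ 2 ^ p) :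
    Real.log x ≤ p / n * Real.log 2 := by
  have h1 := Real.log_le_log (by positivity) h
  rw [Real.log_pow, Real.log_pow] at h1
  have hn' : (0 : ℝ) < n := by exact_mod_cast hn
  rw [div_mul_eq_mul_div, le_div_iff₀ hn']
  linarith

lemma div_mul_log_two_le_log {x : ℝ} {p n : ℕ} (hn : 0 < n) (h : 2 ^ p ≤ x ^ n) :
    p / n * Real.log 2 ≤ Real.log x := by
  have h1 := Real.log_le_log (by positivity) h
  rw [Real.log_pow, Real.log_pow] at h1
  have hn' : (0 : ℝ) < n := by exact_mod_cast hn
  rw [div_mul_eq_mul_div, div_le_iff₀ hn']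
  linarith

lemma kappa_bounds : 0.4472 ≤ kappa ∧ kappa ≤ 0.4473 := by
  have h5 : 0 < Real.sqrt 5 := by positivity
  have hs : Real.sqrt 5 ^ 2 = 5 := Real.sq_sqrt (by norm_num)
  rw [kappa, le_div_iff₀ h5, div_le_iff₀ h5]
  constructor <;> nlinarith

lemma sigma1_bounds {σ : ℝ} (hσ : 1 < σ) :
    1.618 ≤ sigma1 σ ∧ σ ≤ sigma1 σ ∧ sigma1 σ ≤ 1 + σ := by
  have h1 : 2.236 ≤ Real.sqrt (1 + 4 * σ ^ 2) := Real.le_sqrt_of_sq_le (by nlinarith)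
  have h2 : 2 * σ ≤ Real.sqrt (1 + 4 * σ ^ 2) := Real.le_sqrt_of_sq_le (by nlinarith)
  have h3 : Real.sqrt (1 + 4 * σ ^ 2) ≤ 1 + 2 * σ :=
    Real.sqrt_le_iff.2 ⟨by linarith, by nlinarith⟩
  rw [sigma1]
  exact ⟨by linarith, by linarith, by linarith⟩

/-- A numerical upper bound for the difference of digamma values from rational data. -/
lemma re_psi_sub_kappa_le {a a' b b' u G H D : ℝ} {p₁ p₂ n : ℕ} (hn : 0 < n) (ha : 0 < a)
    (haa : a ≤ a') (hb' : 0 < b') (hbb : b' ≤ b) (hu : 0 < u)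
    (hA : (a' ^ 2 + a' + u ^ 2 + 1) ^ n ≤ 2 ^ p₁) (hB : 2 ^ p₂ ≤ (b' ^ 2 + b' + u ^ 2) ^ n)
    (hG : G * (a ^ 2 + u ^ 2) ≤ a) (hH : b ≤ H * (b ^ 2 + u ^ 2))
    (hD : 0.6931471808 * (p₁ / n) / 2 - 0.4472 * (0.6931471803 * (p₂ / n)) / 2 - G + 0.4473 * H
      ≤ D) :
    (psi (a + u * Complex.I)).re - kappa * (psi (b + u * Complex.I)).re ≤ D := by
  obtain ⟨hk1, hk2⟩ := kappa_bounds
  have hk0 : 0 ≤ kappa := by linarith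
  have hb : 0 < b := hb'.trans_le hbb
  refine (re_psi_sub_le ha hb hk0 hu).trans (le_trans ?_ hD)
  have h1 : Real.log (a ^ 2 + a + u ^ 2 + 1) ≤ 0.6931471808 * (p₁ / n) := by
    have hle : (a ^ 2 + a + u ^ 2 + 1) ^ n ≤ 2 ^ p₁ := le_trans (by gcongr) hA
    refine (log_le_div_mul_log_two hn (by positivity) hle).trans ?_
    rw [mul_comm]
    exact mul_le_mul_of_nonneg_right Real.log_two_lt_d9.le (by positivity)
  have h2 : 0.6931471803 * (p₂ / n) ≤ Real.log (b ^ 2 + b + u ^ 2) := by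
    have hle : 2 ^ p₂ ≤ (b ^ 2 + b + u ^ 2) ^ n := hB.trans (by gcongr)
    refine le_trans ?_ (div_mul_log_two_le_log hn hle)
    rw [mul_comm]
    exact mul_le_mul_of_nonneg_left Real.log_two_gt_d9.le (by positivity)
  have h3 : G ≤ a / (a ^ 2 + u ^ 2) := (le_div_iff₀ (by positivity)).2 hG
  have h4 : b / (b ^ 2 + u ^ 2) ≤ H := (div_le_iff₀ (by positivity)).2 hH
  have h5 : kappa * (b / (b ^ 2 + u ^ 2)) ≤ 0.4473 * H :=
    mul_le_mul hk2 h4 (by positivity) (by norm_num)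
  have h6 : 0.4472 * (0.6931471803 * ((p₂ : ℝ) / n)) ≤ kappa * Real.log (b ^ 2 + b + u ^ 2) :=
    mul_le_mul hk1 h2 (by positivity) hk0
  linarith

/-- For `1 < σ ≤ 1.15`, `c ∈ {0,1}`, `k ∈ {1,2,3,4}`, `0 < γ0 ≤ 1`:
`(1/2) Re( ψ((σ+ikγ0+c)/2) - κ ψ((σ1+ikγ0+c)/2) ) ≤ d(k)`, with
`d(1) = -0.0390`, `d(2) = 0.2469`, `d(3) = 0.4452`, `d(4) = 0.5842`. -/
theorem gamma_term_small_t (σ c γ0 : ℝ) (hσ : 1 < σ) (hσ' : σ ≤ 1.15)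
    (hc : c = 0 ∨ c = 1) (k : ℕ) (hk1 : 1 ≤ k) (hk4 : k ≤ 4)
    (hγ0 : 0 < γ0) (hγ1 : γ0 ≤ 1) :
    (1 / 2) * (psi (((σ : ℂ) + ((k : ℝ) * γ0 : ℝ) * Complex.I + (c : ℂ)) / 2)
        - (kappa : ℂ) *
          psi (((sigma1 σ : ℂ) + ((k : ℝ) * γ0 : ℝ) * Complex.I + (c : ℂ)) / 2)).re
      ≤ (if k = 1 then -0.0390 else if k = 2 then 0.2469 else if k = 3 then 0.4452 else (0.5842 : ℝ)) := by
  obtain ⟨hs, hσs, hsσ⟩ := sigma1_bounds hσ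
  obtain ⟨hκ, hκ'⟩ := kappa_bounds
  have hc0 : 0 ≤ c := by rcases hc with rfl | rfl <;> norm_num
  have harg : ∀ x : ℝ, ((x : ℂ) + ((k : ℝ) * γ0 : ℝ) * Complex.I + (c : ℂ)) / 2
      = (((x + c) / 2 : ℝ) : ℂ) + ((k * γ0 / 2 : ℝ) : ℂ) * Complex.I := fun x => by
    push_cast; ring
  rw [harg, harg, Complex.sub_re, Complex.re_ofReal_mul]
  have hk0 : (0 : ℝ) ≤ k := k.cast_nonneg
  have hy : ((k : ℝ) * γ0 / 2) ^ 2 ≤ ((k : ℝ) / 2) ^ 2 := by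
    have : (k : ℝ) * γ0 ≤ k := mul_le_of_le_one_right hk0 hγ1
    gcongr
  have hmono := re_psi_sub_mono (a := (σ + c) / 2) (b := (sigma1 σ + c) / 2) (r := kappa)
    (by linarith) (by linarith) (by linarith) (by nlinarith) hy
  suffices h : (psi (((σ + c) / 2 : ℝ) + ((k / 2 : ℝ) : ℂ) * Complex.I)).re
      - kappa * (psi (((sigma1 σ + c) / 2 : ℝ) + ((k / 2 : ℝ) : ℂ) * Complex.I)).re
      ≤ 2 * (if k = 1 then -0.0390 else if k = 2 then 0.2469 else if k = 3 then 0.4452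
        else (0.5842 : ℝ)) by linarith
  clear hmono hy harg hk0
  have hE : 0 ≤ (σ - 1) * (1.15 - σ) := mul_nonneg (by linarith) (by linarith)
  generalize sigma1 σ = τ at hs hσs hsσ ⊢
  rcases hc with rfl | rfl <;> interval_cases k
  · refine re_psi_sub_kappa_le (a' := 0.575) (b' := 0.809) (G := 0.99) (H := 0.895)
      (p₁ := 3) (p₂ := 1) (n := 2) ?_ ?_ ?_ ?_ ?_ ?_ ?_ ?_ ?_ ?_ ?_ <;> norm_num
    all_goals nlinarith [hE, mul_nonneg (sub_nonneg.2 hs) (sub_nonneg.2 hs)]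
  · refine re_psi_sub_kappa_le (a' := 0.575) (b' := 0.809) (G := 0.4) (H := 0.5)
      (p₁ := 2) (p₂ := 1) (n := 1) ?_ ?_ ?_ ?_ ?_ ?_ ?_ ?_ ?_ ?_ ?_ <;> norm_num
    all_goals nlinarith [hE, sq_nonneg (τ + 0 - 2)]
  · refine re_psi_sub_kappa_le (a' := 0.575) (b' := 0.809) (G := 0.2) (H := (1 / 3))
      (p₁ := 3) (p₂ := 1) (n := 1) ?_ ?_ ?_ ?_ ?_ ?_ ?_ ?_ ?_ ?_ ?_ <;> norm_num
    all_goals nlinarith [hE, sq_nonneg (τ + 0 - 3)]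
  · refine re_psi_sub_kappa_le (a' := 0.575) (b' := 0.809) (G := 0.117) (H := 0.25)
      (p₁ := 3) (p₂ := 2) (n := 1) ?_ ?_ ?_ ?_ ?_ ?_ ?_ ?_ ?_ ?_ ?_ <;> norm_num
    all_goals nlinarith [hE, sq_nonneg (τ + 0 - 4)]
  · refine re_psi_sub_kappa_le (a' := 1.075) (b' := 1.309) (G := 0.764) (H := 0.667)
      (p₁ := 9) (p₂ := 8) (n := 5) ?_ ?_ ?_ ?_ ?_ ?_ ?_ ?_ ?_ ?_ ?_ <;> norm_num
    all_goals nlinarith [hE, mul_nonneg (sub_nonneg.2 hs) (sub_nonneg.2 hs)]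
  · refine re_psi_sub_kappa_le (a' := 1.075) (b' := 1.309) (G := 0.498) (H := 0.5)
      (p₁ := 3) (p₂ := 2) (n := 1) ?_ ?_ ?_ ?_ ?_ ?_ ?_ ?_ ?_ ?_ ?_ <;> norm_num
    all_goals nlinarith [hE, sq_nonneg (τ + 1 - 2)]
  · refine re_psi_sub_kappa_le (a' := 1.075) (b' := 1.309) (G := 0.307) (H := (1 / 3))
      (p₁ := 3) (p₂ := 2) (n := 1) ?_ ?_ ?_ ?_ ?_ ?_ ?_ ?_ ?_ ?_ ?_ <;> norm_num
    all_goals nlinarith [hE, sq_nonneg (τ + 1 - 3)]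
  · refine re_psi_sub_kappa_le (a' := 1.075) (b' := 1.309) (G := 0.2) (H := 0.25)
      (p₁ := 3) (p₂ := 2) (n := 1) ?_ ?_ ?_ ?_ ?_ ?_ ?_ ?_ ?_ ?_ ?_ <;> norm_num
    all_goals nlinarith [hE, sq_nonneg (τ + 1 - 4)]

end ZFR
end
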